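/- arXiv:0711.1512 — 2 statements merged into one kernel-verified Lean document; each statement's English description precedes it below -/
import Mathlib

section
/- If (X, d_X) is an asymptotic ultrametric space (i.e. there is k ≥ 0 with d_X(x,y) ≤ max{d_X(x,z), d_X(y,z)} + k for all x, y, z), then every asymptotic cone Cone_ω(X, c, d) of X is an ultrametric space. -/
open Filter

/-- If `(X, d_X)` is an asymptotic ultrametric space, i.e. there is `k ≥ 0` with
`d_X(x,y) ≤ max{d_X(x,z), d_X(y,z)} + k` for all `x, y, z`, then every asymptotic cone
of `X` is ultrametric: the ultralimit distances satisfy `Dxy ≤ max Dxz Dyz`. -/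
theorem cone_ultrametric_of_asymptotic_ultrametric {X : Type*} [PseudoMetricSpace X]
    (k : ℝ) (hk : 0 ≤ k)
    (hX : ∀ x y z : X, dist x y ≤ max (dist x z) (dist y z) + k)
    (ω : Ultrafilter ℕ) (hω : (ω : Filter ℕ) ≤ cofinite)
    (d : ℕ → ℝ) (hd : ∀ n, 0 < d n) (hdiv : Tendsto d (ω : Filter ℕ) atTop)
    (x y z : ℕ → X) (Dxy Dxz Dyz : ℝ)
    (hxy : Tendsto (fun n => dist (x n) (y n) / d n) (ω : Filter ℕ) (nhds Dxy))
    (hxz : Tendsto (fun n => dist (x n) (z n) / d n) (ω : Filter ℕ) (nhds Dxz))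
    (hyz : Tendsto (fun n => dist (y n) (z n) / d n) (ω : Filter ℕ) (nhds Dyz)) :
    Dxy ≤ max Dxz Dyz := by
  have hk0 : Tendsto (fun n => k / d n) (ω : Filter ℕ) (nhds 0) := hdiv.const_div_atTop k
  have hlim := (hxz.max hyz).add hk0
  rw [add_zero] at hlim
  refine le_of_tendsto_of_tendsto' hxy hlim fun n => ?_
  rw [max_div_div_right (hd n).le, ← add_div]
  exact div_le_div_of_nonneg_right (hX _ _ _) (hd n).le
end

section
/- For each n ∈ ℕ there exists a countable locally finite group Gⁿ with a proper left invariant metric dₙ such that the asymptotic Assouad-Nagata dimension of (Gⁿ, dₙ) is exactly n. -/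
def ScaleChain {X : Type*} (d : X → X → ℝ) (s : ℝ) (U : Set X) (x y : X) : Prop :=
  ∃ (m : ℕ) (c : ℕ → X), c 0 = x ∧ c m = y ∧ (∀ i ≤ m, c i ∈ U) ∧
    ∀ i < m, d (c i) (c (i + 1)) < s

def IsControlFun {X : Type*} (d : X → X → ℝ) (n : ℕ) (D : ℝ → ℝ) : Prop :=
  ∀ s : ℝ, 0 < s → ∃ U : Fin (n + 1) → Set X,
    (∀ x, ∃ i, x ∈ U i) ∧ ∀ i x y, ScaleChain d s (U i) x y → d x y ≤ D s

/-- Asymptotic Assouad-Nagata dimension at most `n`. -/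
def ANdimLE {X : Type*} (d : X → X → ℝ) (n : ℕ) : Prop :=
  ∃ C : ℝ, 0 < C ∧ ∃ b : ℝ, IsControlFun d n (fun s => C * s + b)

/-- Asymptotic dimension at most `n`. -/
def AsdimLE {X : Type*} (d : X → X → ℝ) (n : ℕ) : Prop :=
  ∃ D : ℝ → ℝ, IsControlFun d n D

/-- `d` is a proper left invariant metric on the group `G`. -/
def IsPLIMetric {G : Type*} [Group G] (d : G → G → ℝ) : Prop :=
  (∀ x y : G, d x y = 0 ↔ x = y) ∧ (∀ x y : G, d x y = d y x) ∧
    (∀ x y z : G, d x z ≤ d x y + d y z) ∧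
    (∀ g x y : G, d (g * x) (g * y) = d x y) ∧
    ∀ K : ℝ, {g : G | d 1 g ≤ K}.Finite

/-- A group is locally finite if every finitely generated subgroup is finite. -/
def LocallyFiniteGroup (G : Type*) [Group G] : Prop :=
  ∀ s : Finset G, ((Subgroup.closure (s : Set G) : Subgroup G) : Set G).Finite

lemma det_eq_sum_minors {d : ℕ} (A : Matrix (Fin (d + 1)) (Fin (d + 1)) (ZMod 2))
    (h : ∀ k, ∑ c, A k c = 1) :
    A.det = ∑ i : Fin (d + 1), (A.submatrix i.succAbove Fin.succ).det := by
  have h1 := Matrix.det_updateCol_sum A 0 (fun _ => 1)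
  simp only [one_smul, h] at h1
  rw [← h1, Matrix.det_succ_column_zero]
  refine Finset.sum_congr rfl fun i _ => ?_
  have h2 : (-1 : ZMod 2) = 1 := by decide
  rw [h2]
  simp
  rfl

/-- The `k`-th vertex of the simplex of the Kuhn triangulation with base point `x` and order `σ`
of the coordinates. -/
def kuhnVertex {D : ℕ} (x : Fin D → ℕ) (σ : Equiv.Perm (Fin D)) (k : ℕ) : Fin D → ℕ :=
  fun j => x j + if (σ j : ℕ) < k then 1 else 0

/-- The `k`-th vertex of the face of a Kuhn simplex orthogonal to the coordinate in position `0`. -/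
def kuhnFacet {D : ℕ} (y : Fin D → ℕ) (σ : Equiv.Perm (Fin D)) (k : ℕ) : Fin D → ℕ :=
  fun j => y j + if 0 < (σ j : ℕ) ∧ (σ j : ℕ) ≤ k then 1 else 0

lemma sum_interior_faces {d : ℕ} (g : (Fin (d + 1) → Fin (d + 1) → ℕ) → ZMod 2)
    (x : Fin (d + 1) → ℕ) (m : Fin d) :
    ∑ σ : Equiv.Perm (Fin (d + 1)),
      g (fun k => kuhnVertex x σ ((m.castSucc.succ : Fin (d + 2)).succAbove k)) = 0 := by
  refine Finset.sum_involution (fun σ _ => Equiv.swap m.castSucc m.succ * σ) ?_ ?_ ?_ ?_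
  · intro σ _
    have : (fun k : Fin (d + 1) => kuhnVertex x (Equiv.swap m.castSucc m.succ * σ)
        ((m.castSucc.succ : Fin (d + 2)).succAbove k)) =
        fun k => kuhnVertex x σ ((m.castSucc.succ : Fin (d + 2)).succAbove k) := by
      funext k j
      have hk : (((m.castSucc.succ : Fin (d + 2)).succAbove k : Fin (d + 2)) : ℕ) ≠ m + 1 := by
        intro h
        exact Fin.succAbove_ne (m.castSucc.succ : Fin (d + 2)) k (Fin.ext (by simpa using h))
      simp only [kuhnVertex, Equiv.Perm.mul_apply]
      generalize ((m.castSucc.succ : Fin (d + 2)).succAbove k : Fin (d + 2)) = q at hk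
      congr 2
      rw [Equiv.swap_apply_def]
      split_ifs with h1 h2
      · simp [h1]; omega
      · simp [h2]; omega
      · rfl
    rw [this]
    exact CharTwo.add_self_eq_zero _
  · intro σ _ _ h
    have h1 := mul_eq_right.mp h
    rw [Equiv.swap_eq_one_iff] at h1
    simp [Fin.ext_iff] at h1
  · intro σ _
    exact Finset.mem_univ _
  · intro σ _
    simp [← mul_assoc]

lemma kuhnVertex_succ_eq {d : ℕ} (x : Fin (d + 1) → ℕ) (σ : Equiv.Perm (Fin (d + 1)))
    (k : Fin (d + 1)) :
    kuhnVertex x σ (k.succ : Fin (d + 2)) =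
      kuhnFacet (Function.update x (σ⁻¹ 0) (x (σ⁻¹ 0) + 1)) σ k := by
  funext j
  simp only [kuhnVertex, kuhnFacet, Fin.val_succ, Function.update_apply]
  by_cases hj : j = σ⁻¹ 0
  · subst hj
    simp
  · have : σ j ≠ 0 := fun h => hj (by rw [← h]; simp)
    have : (σ j : ℕ) ≠ 0 := fun h => this (Fin.ext h)
    rw [if_neg hj]
    congr 2
    apply propext
    omega

lemma kuhnVertex_castSucc_eq {d : ℕ} (x : Fin (d + 1) → ℕ) (σ : Equiv.Perm (Fin (d + 1)))
    (k : Fin (d + 1)) :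
    kuhnVertex x σ (k.castSucc : Fin (d + 2)) = kuhnFacet x (finRotate (d + 1) * σ) k := by
  funext j
  simp only [kuhnVertex, kuhnFacet, Fin.val_castSucc, Equiv.Perm.mul_apply, coe_finRotate]
  congr 2
  apply propext
  have := k.2
  split_ifs with h
  · simp [h]; omega
  · omega

lemma sum_faces {d : ℕ} (g : (Fin (d + 1) → Fin (d + 1) → ℕ) → ZMod 2)
    (x : Fin (d + 1) → ℕ) :
    ∑ σ : Equiv.Perm (Fin (d + 1)), ∑ i : Fin (d + 2),
        g (fun k => kuhnVertex x σ (i.succAbove k)) =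
      ∑ σ : Equiv.Perm (Fin (d + 1)),
        (g (fun k => kuhnFacet (Function.update x (σ⁻¹ 0) (x (σ⁻¹ 0) + 1)) σ k) +
          g (fun k => kuhnFacet x σ k)) := by
  rw [Finset.sum_comm, Fin.sum_univ_succ, Fin.sum_univ_castSucc]
  simp only [Fin.succ_castSucc]
  have h0 : ∀ m : Fin d, ∑ σ : Equiv.Perm (Fin (d + 1)),
      g (fun k => kuhnVertex x σ ((m.succ.castSucc : Fin (d + 2)).succAbove k)) = 0 := fun m => by
    simpa only [Fin.succ_castSucc] using sum_interior_faces g x m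
  rw [Finset.sum_eq_zero fun m _ => h0 m, zero_add, Finset.sum_add_distrib]
  congr 1
  · simp only [Fin.succAbove_zero, kuhnVertex_succ_eq]
  · simp only [Fin.succ_last, Fin.succAbove_last, kuhnVertex_castSucc_eq]
    exact Equiv.sum_comp (Equiv.mulLeft (finRotate (d + 1)))
      (fun σ => g (fun k => kuhnFacet x σ k))

lemma sum_box_telescope {d M : ℕ} (F : (Fin (d + 1) → ℕ) → ZMod 2) (j : Fin (d + 1)) :
    ∑ x : Fin (d + 1) → Fin M,
        (F (Function.update (fun i => (x i : ℕ)) j ((x j : ℕ) + 1)) + F (fun i => (x i : ℕ))) =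
      ∑ z : Fin d → Fin M,
        (F (j.insertNth M (fun i => (z i : ℕ))) + F (j.insertNth 0 (fun i => (z i : ℕ)))) := by
  rw [← Equiv.sum_comp (Fin.insertNthEquiv (fun _ => Fin M) j), Fintype.sum_prod_type_right]
  refine Finset.sum_congr rfl fun z _ => ?_
  have h1 : ∀ t : Fin M, (fun i => ((j.insertNth (α := fun _ => Fin M) t z i : Fin M) : ℕ)) =
      j.insertNth (α := fun _ => ℕ) (t : ℕ) (fun i => (z i : ℕ)) := by
    intro t
    funext i
    refine Fin.succAboveCases j ?_ ?_ i
    · simp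
    · simp
  have h2 : ∀ t : Fin M, F (Function.update
      (j.insertNth (α := fun _ => ℕ) (t : ℕ) (fun i => (z i : ℕ))) j ((t : ℕ) + 1)) =
      F (j.insertNth (α := fun _ => ℕ) ((t : ℕ) + 1) (fun i => (z i : ℕ))) := by
    intro t
    simp
  simp only [Fin.insertNthEquiv_apply, h1, Fin.insertNth_apply_same, h2]
  rw [Fin.sum_univ_eq_sum_range (fun t : ℕ =>
    F (j.insertNth (α := fun _ => ℕ) (t + 1) (fun i => (z i : ℕ))) +
      F (j.insertNth (α := fun _ => ℕ) t (fun i => (z i : ℕ)))) M]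
  have h3 := Finset.sum_range_sub
    (fun t : ℕ => F (j.insertNth (α := fun _ => ℕ) t (fun i => (z i : ℕ)))) M
  simpa only [CharTwo.sub_eq_add] using h3

lemma kuhnFacet_decomposeFin {d : ℕ} (M : ℕ) (z : Fin d → ℕ) (e : Equiv.Perm (Fin d)) (k : ℕ) :
    kuhnFacet (Fin.cons M z : Fin (d + 1) → ℕ) (Equiv.Perm.decomposeFin.symm (0, e)) k =
      Fin.cons M (kuhnVertex z e k) := by
  funext j
  refine Fin.cases ?_ (fun i => ?_) j
  · simp [kuhnFacet]
  · simp [kuhnFacet, kuhnVertex]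

/-- Sperner's lemma for the Kuhn triangulation of a cube, with labels replaced by partitions of
unity modulo two. -/
theorem kuhn_sum (D M : ℕ) (F : (Fin D → ℕ) → Fin (D + 1) → ZMod 2)
    (hsum : ∀ x, ∑ c, F x c = 1) (htop : ∀ x i, x i = M → F x i.castSucc = 0)
    (hbot : ∀ x i, x i = 0 → F x (Fin.last D) = 0) :
    ∑ x : Fin D → Fin M, ∑ σ : Equiv.Perm (Fin D),
      (Matrix.of fun k c : Fin (D + 1) => F (kuhnVertex (fun i => (x i : ℕ)) σ k) c).det = 1 := by
  induction D with
  | zero =>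
    have h : ∀ x, F x 0 = 1 := fun x => by simpa using hsum x
    simp [h]
  | succ d ih =>
    let g : (Fin (d + 1) → Fin (d + 1) → ℕ) → ZMod 2 :=
      fun w => (Matrix.of fun k c : Fin (d + 1) => F (w k) c.succ).det
    have hdet : ∀ (x : Fin (d + 1) → ℕ) (σ : Equiv.Perm (Fin (d + 1))),
        (Matrix.of fun k c : Fin (d + 1 + 1) => F (kuhnVertex x σ k) c).det =
          ∑ i : Fin (d + 2), g (fun k => kuhnVertex x σ (i.succAbove k)) := by
      intro x σ
      rw [det_eq_sum_minors _ (fun k => by simpa using hsum _)]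
      rfl
    simp only [hdet, sum_faces]
    rw [Finset.sum_comm]
    have htel : ∀ σ : Equiv.Perm (Fin (d + 1)), ∑ x : Fin (d + 1) → Fin M,
        (g (fun k => kuhnFacet (Function.update (fun i => (x i : ℕ)) (σ⁻¹ 0)
            ((x (σ⁻¹ 0) : ℕ) + 1)) σ k) + g (fun k => kuhnFacet (fun i => (x i : ℕ)) σ k)) =
        ∑ z : Fin d → Fin M,
          g (fun k => kuhnFacet ((σ⁻¹ 0).insertNth M (fun i => (z i : ℕ))) σ k) := by
      intro σ
      rw [sum_box_telescope (fun y => g (fun k => kuhnFacet y σ k)) (σ⁻¹ 0)]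
      refine Finset.sum_congr rfl fun z _ => ?_
      rw [add_eq_left]
      refine Matrix.det_eq_zero_of_column_eq_zero (Fin.last d) fun k => ?_
      exact hbot _ (σ⁻¹ 0) (by simp [kuhnFacet])
    rw [Finset.sum_congr rfl fun σ _ => htel σ,
      ← Equiv.sum_comp Equiv.Perm.decomposeFin.symm, Fintype.sum_prod_type, Fin.sum_univ_succ]
    rw [Finset.sum_eq_zero (s := Finset.univ (α := Fin d)), add_zero]
    · rw [Finset.sum_comm]
      rw [← ih (fun y c => F (Fin.cons M y) c.succ)]
      · refine Finset.sum_congr rfl fun z _ => Finset.sum_congr rfl fun e _ => ?_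
        have h0 : (Equiv.Perm.decomposeFin.symm (0, e))⁻¹ 0 = 0 := by
          rw [Equiv.Perm.inv_eq_iff_eq]; simp
        rw [h0, Fin.insertNth_zero']
        simp only [kuhnFacet_decomposeFin]
        rfl
      · intro y
        have h := hsum (Fin.cons M y)
        rw [Fin.sum_univ_succ] at h
        have h0 := htop (Fin.cons M y) 0 (by simp)
        rw [Fin.castSucc_zero] at h0
        rwa [h0, zero_add] at h
      · intro y i hi
        rw [Fin.succ_castSucc]
        exact htop _ _ (by simpa using hi)
      · intro y i hi
        rw [Fin.succ_last]
        exact hbot _ i.succ (by simpa using hi)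
    · intro p _
      refine Finset.sum_eq_zero fun e _ => Finset.sum_eq_zero fun z _ => ?_
      set σ := Equiv.Perm.decomposeFin.symm (p.succ, e) with hσ
      have hne : σ⁻¹ 0 ≠ 0 := by
        rw [Ne, Equiv.Perm.inv_eq_iff_eq, hσ]
        simp [eq_comm]
      obtain ⟨c, hc⟩ := Fin.exists_succ_eq.mpr hne
      refine Matrix.det_eq_zero_of_column_eq_zero c.castSucc fun k => ?_
      have h := htop (kuhnFacet ((σ⁻¹ 0).insertNth M (fun i => (z i : ℕ))) σ k) (σ⁻¹ 0)
        (by simp [kuhnFacet])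
      have hc' : (σ⁻¹ 0).castSucc = c.castSucc.succ := by rw [← hc, Fin.succ_castSucc]
      rwa [hc'] at h

lemma kuhnVertex_adj {D : ℕ} (x : Fin D → ℕ) (σ : Equiv.Perm (Fin D)) (k l : ℕ) (i : Fin D) :
    kuhnVertex x σ k i ≤ kuhnVertex x σ l i + 1 := by
  simp only [kuhnVertex]
  split_ifs <;> omega

/-- Every labelling of a cube with the boundary behaviour of Kuhn's cubical Sperner lemma has a
cell on which all labels occur. -/
theorem exists_fully_labelled (D M : ℕ) (L : (Fin D → ℕ) → Fin (D + 1))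
    (htop : ∀ x i, x i = M → L x ≠ i.castSucc) (hbot : ∀ x i, x i = 0 → L x ≠ Fin.last D) :
    ∃ v : Fin (D + 1) → Fin D → ℕ, (∀ c, L (v c) = c) ∧ (∀ c i, v c i ≤ M) ∧
      ∀ c c' i, v c i ≤ v c' i + 1 := by
  have h := kuhn_sum D M (fun x c => if L x = c then 1 else 0) (fun x => by simp)
    (fun x i hx => if_neg (htop x i hx)) (fun x i hx => if_neg (hbot x i hx))
  obtain ⟨x, -, hx⟩ := Finset.exists_ne_zero_of_sum_ne_zero (h.trans_ne one_ne_zero)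
  obtain ⟨σ, -, hσ⟩ := Finset.exists_ne_zero_of_sum_ne_zero hx
  have hsurj : ∀ c, ∃ k : Fin (D + 1), L (kuhnVertex (fun i => (x i : ℕ)) σ k) = c := by
    intro c
    by_contra! hc
    exact hσ (Matrix.det_eq_zero_of_column_eq_zero c fun k => if_neg (hc k))
  choose k hk using hsurj
  refine ⟨fun c => kuhnVertex (fun i => (x i : ℕ)) σ (k c), hk, fun c i => ?_,
    fun c c' i => kuhnVertex_adj _ _ _ _ _⟩
  have := (x i).2
  simp only [kuhnVertex]
  split_ifs <;> omega

/-- The Hex theorem: in a cube with `D` pairs of opposite faces coloured with `D` colours, a set `P`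
of points which is a union of colour components and contains all points of colour `i` on the `i`-th
upper face also contains a point of colour `i` on the `i`-th lower face, for some `i`. -/
theorem hex (D M : ℕ) (hM : 0 < M) (col : (Fin D → ℕ) → Fin D) (P : (Fin D → ℕ) → Prop)
    (htop : ∀ y, (∀ i, 0 < y i) → y (col y) = M → P y)
    (hadj : ∀ y z, (∀ i, 0 < y i ∧ y i ≤ M) → (∀ i, 0 < z i ∧ z i ≤ M) →
      (∀ i, y i ≤ z i + 1 ∧ z i ≤ y i + 1) → col y = col z → P y → P z)
    (hbot : ∀ y, (∀ i, 0 < y i ∧ y i ≤ M) → P y → y (col y) ≠ 1) : False := by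
  classical
  let L : (Fin D → ℕ) → Fin (D + 1) := fun y =>
    if h : ∃ i, y i = 0 then h.choose.castSucc
    else if P y then Fin.last D else (col y).castSucc
  have hLtop : ∀ x i, x i = M → L x ≠ i.castSucc := by
    intro x i hx h
    by_cases h0 : ∃ i, x i = 0
    · simp only [L, dif_pos h0] at h
      have h1 := h0.choose_spec
      rw [Fin.castSucc_injective _ h] at h1
      omega
    · simp only [L, dif_neg h0] at h
      push Not at h0
      split_ifs at h with hP
      · exact (Fin.castSucc_lt_last _).ne h.symm
      · have h1 := Fin.castSucc_injective _ h
        exact hP (htop x (fun i => Nat.pos_of_ne_zero (h0 i)) (by rw [h1, hx]))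
  have hLbot : ∀ x i, x i = 0 → L x ≠ Fin.last D := by
    intro x i hx h
    have h0 : ∃ i, x i = 0 := ⟨i, hx⟩
    simp only [L, dif_pos h0] at h
    exact (Fin.castSucc_lt_last _).ne h
  obtain ⟨v, hL, hv, hvv⟩ := exists_fully_labelled D M L hLtop hLbot
  have hlast := hL (Fin.last D)
  set y := v (Fin.last D)
  have hy0 : ¬ ∃ i, y i = 0 := by
    intro h
    simp only [L, dif_pos h] at hlast
    exact (Fin.castSucc_lt_last _).ne hlast
  have hPy : P y := by
    by_contra h
    simp only [L, dif_neg hy0, if_neg h] at hlast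
    exact (Fin.castSucc_lt_last _).ne hlast
  push Not at hy0
  have hybox : ∀ i, 0 < y i ∧ y i ≤ M := fun i => ⟨Nat.pos_of_ne_zero (hy0 i), hv _ i⟩
  have hj := hL (col y).castSucc
  set z := v (col y).castSucc
  have hyz : ∀ i, y i ≤ z i + 1 ∧ z i ≤ y i + 1 := fun i => ⟨hvv _ _ i, hvv _ _ i⟩
  by_cases hz0 : ∃ i, z i = 0
  · simp only [L, dif_pos hz0] at hj
    have h1 := hz0.choose_spec
    rw [Fin.castSucc_injective _ hj] at h1
    refine hbot y hybox hPy ?_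
    have := hyz (col y)
    have := hybox (col y)
    omega
  · simp only [L, dif_neg hz0] at hj
    have hPz : ¬ P z := by
      intro h
      rw [if_pos h] at hj
      exact (Fin.castSucc_lt_last _).ne hj.symm
    rw [if_neg hPz] at hj
    push Not at hz0
    exact hPz (hadj y z hybox (fun i => ⟨Nat.pos_of_ne_zero (hz0 i), hv _ i⟩) hyz
      (Fin.castSucc_injective _ hj).symm hPy)

lemma natAbs_valMinAbs_intCast_le {k : ℕ} [NeZero k] (u : ℤ) :
    (u : ZMod k).valMinAbs.natAbs ≤ u.natAbs :=
  ZMod.natAbs_min_of_le_div_two k _ _ (by simp) (ZMod.natAbs_valMinAbs_le _)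

/-- The direct sum of the groups `(ZMod (2 ^ (n + j))) ^ n` over all `j : ℕ`. -/
abbrev TorusSum (n : ℕ) : Type :=
  Π₀ p : ℕ × Fin n, ZMod (2 ^ (n + p.1))

/-- The scale of the `j`-th torus. -/
def torusScale (n j : ℕ) : ℕ := 2 ^ (j * (n + j))

/-- The maximum of the rescaled sup norms of the components. -/
def torusNorm {n : ℕ} (x : TorusSum n) : ℕ :=
  x.support.sup fun p => torusScale n p.1 * (x p).valMinAbs.natAbs

/-- The left invariant metric of the norm `torusNorm`. -/
def torusDist (n : ℕ) (x y : Multiplicative (TorusSum n)) : ℝ :=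
  torusNorm (-x.toAdd + y.toAdd)

lemma torusNorm_le_iff {n : ℕ} {x : TorusSum n} {K : ℕ} :
    torusNorm x ≤ K ↔ ∀ p, torusScale n p.1 * (x p).valMinAbs.natAbs ≤ K := by
  rw [torusNorm, Finset.sup_le_iff]
  refine ⟨fun h p => ?_, fun h p _ => h p⟩
  by_cases hp : x p = 0
  · simp [hp]
  · exact h p (by simpa using hp)

lemma le_torusNorm {n : ℕ} (x : TorusSum n) (p : ℕ × Fin n) :
    torusScale n p.1 * (x p).valMinAbs.natAbs ≤ torusNorm x :=
  torusNorm_le_iff.mp le_rfl p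

lemma torusScale_pos (n j : ℕ) : 0 < torusScale n j := by
  unfold torusScale
  positivity

lemma torusNorm_eq_zero_iff {n : ℕ} {x : TorusSum n} : torusNorm x = 0 ↔ x = 0 := by
  rw [← Nat.le_zero, torusNorm_le_iff, DFunLike.ext_iff]
  refine forall_congr' fun p => ?_
  have := (torusScale_pos n p.1).ne'
  simp [this]

lemma torusNorm_neg {n : ℕ} (x : TorusSum n) : torusNorm (-x) = torusNorm x :=
  eq_of_forall_ge_iff fun K => by simp [torusNorm_le_iff, ZMod.natAbs_valMinAbs_neg]

lemma torusNorm_add_le {n : ℕ} (x y : TorusSum n) :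
    torusNorm (x + y) ≤ torusNorm x + torusNorm y := by
  refine torusNorm_le_iff.mpr fun p => ?_
  have h1 : (x p + y p).valMinAbs.natAbs ≤ (x p).valMinAbs.natAbs + (y p).valMinAbs.natAbs :=
    (ZMod.natAbs_valMinAbs_add_le _ _).trans (Int.natAbs_add_le _ _)
  calc torusScale n p.1 * ((x + y) p).valMinAbs.natAbs
      ≤ torusScale n p.1 * ((x p).valMinAbs.natAbs + (y p).valMinAbs.natAbs) :=
        Nat.mul_le_mul_left _ h1
    _ ≤ torusNorm x + torusNorm y := by
        rw [mul_add]
        exact add_le_add (le_torusNorm x p) (le_torusNorm y p)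

/-- The subgroup of the first `N` summands. -/
def torusTrunc (n N : ℕ) : AddSubgroup (TorusSum n) where
  carrier := {x | ∀ p : ℕ × Fin n, N ≤ p.1 → x p = 0}
  zero_mem' := fun _ _ => rfl
  add_mem' := fun {x y} hx hy p hp => by simp [hx p hp, hy p hp]
  neg_mem' := fun {x} hx p hp => by simp [hx p hp]

lemma torusTrunc_finite (n N : ℕ) : (torusTrunc n N : Set (TorusSum n)).Finite := by
  let f : torusTrunc n N → (∀ p : Fin N × Fin n, ZMod (2 ^ (n + (p.1 : ℕ)))) :=
    fun x p => x.1 (p.1, p.2)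
  refine Set.finite_coe_iff.mp (Finite.of_injective f fun x y h => ?_)
  ext p
  by_cases hp : N ≤ p.1
  · rw [x.2 p hp, y.2 p hp]
  · exact congrFun h (⟨p.1, by omega⟩, p.2)

lemma lt_torusScale {n j K : ℕ} (h : K < j) : K < torusScale n j := by
  have h1 : j ≤ j * (n + j) := Nat.le_mul_of_pos_right _ (by omega)
  calc K < 2 ^ K := Nat.lt_two_pow_self
    _ ≤ 2 ^ (j * (n + j)) := Nat.pow_le_pow_right (by norm_num) (by omega)

lemma eq_zero_of_torusNorm_lt {n : ℕ} {x : TorusSum n} {p : ℕ × Fin n}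
    (h : torusNorm x < torusScale n p.1) : x p = 0 := by
  rw [← ZMod.valMinAbs_eq_zero, ← Int.natAbs_eq_zero]
  by_contra h0
  exact absurd ((Nat.le_mul_of_pos_right _ (Nat.pos_of_ne_zero h0)).trans (le_torusNorm x p))
    h.not_ge

lemma mem_torusTrunc (n : ℕ) (x : TorusSum n) {K : ℕ} (h : torusNorm x ≤ K) :
    x ∈ torusTrunc n (K + 1) :=
  fun _ hp => eq_zero_of_torusNorm_lt (h.trans_lt (lt_torusScale hp))

lemma isPLIMetric_torusDist (n : ℕ) : IsPLIMetric (torusDist n) := by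
  refine ⟨fun x y => ?_, fun x y => ?_, fun x y z => ?_, fun g x y => ?_, fun K => ?_⟩
  · rw [torusDist, Nat.cast_eq_zero, torusNorm_eq_zero_iff, neg_add_eq_zero]
    exact Multiplicative.toAdd.injective.eq_iff
  · rw [torusDist, torusDist, ← torusNorm_neg]
    congr 2
    abel
  · rw [torusDist, torusDist, torusDist]
    have h : -x.toAdd + z.toAdd = (-x.toAdd + y.toAdd) + (-y.toAdd + z.toAdd) := by abel
    rw [h]
    exact_mod_cast torusNorm_add_le _ _
  · rw [torusDist, torusDist]
    congr 2
    simp only [toAdd_mul]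
    abel
  · refine ((torusTrunc_finite n (⌊K⌋₊ + 1)).preimage
      Multiplicative.toAdd.injective.injOn).subset fun g hg => ?_
    have hg' : (torusNorm g.toAdd : ℝ) ≤ K := by simpa [torusDist] using hg
    exact mem_torusTrunc n _ (Nat.le_floor hg')

lemma locallyFiniteGroup_torusSum (n : ℕ) :
    LocallyFiniteGroup (Multiplicative (TorusSum n)) := by
  intro s
  refine ((torusTrunc_finite n (s.sup (fun g => torusNorm g.toAdd) + 1)).preimage
      Multiplicative.toAdd.injective.injOn).subset ?_
  change ((Subgroup.closure (s : Set (Multiplicative (TorusSum n))) :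
    Subgroup (Multiplicative (TorusSum n))) : Set (Multiplicative (TorusSum n))) ⊆
      (AddSubgroup.toSubgroup (torusTrunc n (s.sup (fun g => torusNorm g.toAdd) + 1)) : Set _)
  rw [SetLike.coe_subset_coe, Subgroup.closure_le]
  intro g hg
  exact mem_torusTrunc n _ (Finset.le_sup (f := fun g => torusNorm g.toAdd) hg)

lemma countable_of_isPLIMetric {G : Type*} [Group G] {d : G → G → ℝ} (h : IsPLIMetric d) :
    Countable G := by
  rw [← Set.countable_univ_iff]
  refine (Set.countable_iUnion fun K : ℕ => (h.2.2.2.2 K).countable).mono fun g _ => ?_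
  exact Set.mem_iUnion.mpr (exists_nat_ge (d 1 g))

/-- The index modulo `2 ^ n` of the arc of length `2 ^ r` containing a point of a cycle. -/
def arcIndex (n j r : ℕ) (z : ZMod (2 ^ (n + j))) : ℤ :=
  (z.val : ℤ) / 2 ^ r % 2 ^ n

lemma arcIndex_intCast {n j r : ℕ} (hr : r ≤ j) (w : ℤ) :
    arcIndex n j r (w : ZMod (2 ^ (n + j))) = w / 2 ^ r % 2 ^ n := by
  obtain ⟨q, rfl⟩ := Nat.exists_eq_add_of_le hr
  have h : w % 2 ^ (n + (r + q)) =
      w + 2 ^ r * (2 ^ n * (-2 ^ q * (w / 2 ^ (n + (r + q))))) := by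
    rw [Int.emod_def]
    ring
  rw [arcIndex, ZMod.val_intCast]
  push_cast
  rw [h, Int.add_mul_ediv_left _ _ (by positivity), Int.add_mul_emod_self_left]

lemma emod_lt_of_arcIndex_ne {N R w i : ℤ} (hR : 0 < R) (hi : 0 ≤ i) (hiN : i < N)
    (h : w / R % N ≠ i) : (w - (i + 1) * R) % (N * R) < N * R - R := by
  by_contra! hc
  apply h
  have h1 := Int.emod_add_mul_ediv (w - (i + 1) * R) (N * R)
  have h2 := Int.emod_lt_of_pos (w - (i + 1) * R) (show 0 < N * R by nlinarith)
  set q := (w - (i + 1) * R) / (N * R)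
  set t := (w - (i + 1) * R) % (N * R)
  have h3 : w = (t - (N * R - R)) + R * (i + N * (q + 1)) := by linear_combination -h1
  rw [h3, Int.add_mul_ediv_left _ _ hR.ne', Int.ediv_eq_zero_of_lt (by linarith) (by linarith),
    zero_add, Int.add_mul_emod_self_left, Int.emod_eq_of_lt hi hiN]

lemma ediv_eq_of_emod_lt {L R w δ : ℤ} (hL : 0 < L) (hδ : |δ| < R) (h1 : w % L < L - R)
    (h2 : (w + δ) % L < L - R) : (w + δ) / L = w / L := by
  have e1 := Int.emod_add_mul_ediv w L
  have e2 := Int.emod_add_mul_ediv (w + δ) L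
  have p1 := Int.emod_nonneg w hL.ne'
  have p2 := Int.emod_nonneg (w + δ) hL.ne'
  rw [abs_lt] at hδ
  refine le_antisymm ?_ ?_
  · by_contra! hc
    nlinarith
  · by_contra! hc
    nlinarith

lemma natAbs_valMinAbs_le_of_chain {n j r : ℕ} (hr : r ≤ j) {i : ℤ} (hi : 0 ≤ i)
    (hin : i < 2 ^ n) (c : ℕ → ZMod (2 ^ (n + j))) (m : ℕ)
    (hc : ∀ t ≤ m, arcIndex n j r (c t) ≠ i)
    (hstep : ∀ t < m, (-c t + c (t + 1)).valMinAbs.natAbs < 2 ^ r) :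
    (-c 0 + c m).valMinAbs.natAbs ≤ 2 ^ n * 2 ^ r := by
  have hR : (0 : ℤ) < 2 ^ r := by positivity
  have hL : (0 : ℤ) < 2 ^ n * 2 ^ r := by positivity
  obtain ⟨v, hv⟩ : ∃ v : ℤ, (v : ZMod (2 ^ (n + j))) = c 0 := ⟨_, ZMod.coe_valMinAbs _⟩
  have key : ∀ t ≤ m, ∃ w : ℤ, (w : ZMod (2 ^ (n + j))) = c t ∧
      (w - (i + 1) * 2 ^ r) / (2 ^ n * 2 ^ r) = (v - (i + 1) * 2 ^ r) / (2 ^ n * 2 ^ r) := by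
    intro t
    induction t with
    | zero => exact fun _ => ⟨v, hv, rfl⟩
    | succ t ih =>
      intro ht
      obtain ⟨w, hw, hq⟩ := ih (by omega)
      set δ := (-c t + c (t + 1)).valMinAbs with hδ
      have hw' : ((w + δ : ℤ) : ZMod (2 ^ (n + j))) = c (t + 1) := by
        rw [Int.cast_add, hδ, ZMod.coe_valMinAbs, hw]
        ring
      refine ⟨w + δ, hw', ?_⟩
      have hlt : ∀ u : ℤ, ∀ s ≤ m, (u : ZMod (2 ^ (n + j))) = c s →
          (u - (i + 1) * 2 ^ r) % (2 ^ n * 2 ^ r) < 2 ^ n * 2 ^ r - 2 ^ r := by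
        intro u s hs hu
        refine emod_lt_of_arcIndex_ne hR hi hin ?_
        rw [← arcIndex_intCast hr, hu]
        exact hc s hs
      have h1 := hlt w t (by omega) hw
      have h2 := hlt (w + δ) (t + 1) ht hw'
      rw [← hq, add_sub_right_comm]
      rw [add_sub_right_comm] at h2
      refine ediv_eq_of_emod_lt hL ?_ h1 h2
      have h3 := hstep t (by omega)
      rw [Int.abs_eq_natAbs]
      exact_mod_cast h3
  obtain ⟨w, hw, hq⟩ := key m le_rfl
  have hcast : -c 0 + c m = ((w - v : ℤ) : ZMod (2 ^ (n + j))) := by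
    rw [Int.cast_sub, hw, hv]
    ring
  rw [hcast]
  refine (natAbs_valMinAbs_intCast_le _).trans ?_
  have e1 := Int.emod_add_mul_ediv (w - (i + 1) * 2 ^ r) (2 ^ n * 2 ^ r)
  have e2 := Int.emod_add_mul_ediv (v - (i + 1) * 2 ^ r) (2 ^ n * 2 ^ r)
  have a1 := Int.emod_nonneg (w - (i + 1) * 2 ^ r) hL.ne'
  have a2 := Int.emod_nonneg (v - (i + 1) * 2 ^ r) hL.ne'
  have b1 := Int.emod_lt_of_pos (w - (i + 1) * 2 ^ r) hL
  have b2 := Int.emod_lt_of_pos (v - (i + 1) * 2 ^ r) hL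
  rw [hq] at e1
  have h : |w - v| ≤ 2 ^ n * 2 ^ r := by
    rw [abs_le]
    constructor <;> linarith
  rw [Int.abs_eq_natAbs] at h
  exact_mod_cast h

lemma exists_two_pow_near {s : ℝ} (hs : 0 < s) : ∃ e : ℕ, s ≤ 2 ^ e ∧ (2 : ℝ) ^ e ≤ 2 * s + 1 := by
  classical
  have h : ∃ e : ℕ, s ≤ 2 ^ e := (pow_unbounded_of_one_lt s one_lt_two).imp fun _ => le_of_lt
  refine ⟨Nat.find h, Nat.find_spec h, ?_⟩
  rcases he : Nat.find h with _ | e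
  · simp [hs.le]
  · have h1 := Nat.find_min h (show e < Nat.find h by omega)
    rw [pow_succ]
    linarith

lemma torusScale_exponent_strict {n i j : ℕ} (h : i < j) : i * (n + i) + i ≤ j * (n + j) := by
  nlinarith

/-- The points none of whose coordinates at intermediate scales lies in an arc of index `i`. -/
def torusColour (n e i : ℕ) : Set (Multiplicative (TorusSum n)) :=
  {x | ∀ p : ℕ × Fin n, p.1 * (n + p.1) < e → e < p.1 * (n + p.1) + p.1 →
    arcIndex n p.1 (e - p.1 * (n + p.1)) (x.toAdd p) ≠ i}

lemma exists_mem_torusColour {n : ℕ} (e : ℕ) (x : Multiplicative (TorusSum n)) :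
    ∃ i : Fin (n + 1), x ∈ torusColour n e i := by
  by_contra! h
  simp only [torusColour, Set.mem_ofPred_eq, not_forall, not_not] at h
  choose f h1 h2 h3 using h
  have hinj : Function.Injective fun i => (f i).2 := by
    intro i i' hii
    have hfst : (f i).1 = (f i').1 := by
      rcases lt_trichotomy (f i).1 (f i').1 with hlt | heq | hlt
      · have := torusScale_exponent_strict (n := n) hlt
        have := h2 i
        have := h1 i'
        omega
      · exact heq
      · have := torusScale_exponent_strict (n := n) hlt
        have := h2 i'
        have := h1 i
        omega
    have hf : f i = f i' := Prod.ext hfst hii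
    have h3i := h3 i
    rw [hf, h3 i'] at h3i
    exact Fin.ext (by exact_mod_cast h3i.symm)
  simpa using Fintype.card_le_of_injective _ hinj

lemma torusDist_le_of_scaleChain {n e i : ℕ} (hi : i ≤ n) {s : ℝ} (hs : s ≤ 2 ^ e)
    {x y : Multiplicative (TorusSum n)} (h : ScaleChain (torusDist n) s (torusColour n e i) x y) :
    torusDist n x y ≤ 2 ^ n * 2 ^ e := by
  obtain ⟨m, c, rfl, rfl, hc, hd⟩ := h
  have hstep : ∀ t < m, torusNorm (-(c t).toAdd + (c (t + 1)).toAdd) < 2 ^ e := fun t ht => by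
    have := (hd t ht).trans_le hs
    rw [torusDist] at this
    exact_mod_cast this
  have key : torusNorm (-(c 0).toAdd + (c m).toAdd) ≤ 2 ^ n * 2 ^ e := by
    refine torusNorm_le_iff.mpr fun p => ?_
    rw [DFinsupp.add_apply, DFinsupp.neg_apply]
    rcases le_or_gt e (p.1 * (n + p.1)) with h1 | h1
    · have hconst : ∀ t ≤ m, (c t).toAdd p = (c 0).toAdd p := by
        intro t
        induction t with
        | zero => exact fun _ => rfl
        | succ t ih =>
          intro ht
          have h2 := eq_zero_of_torusNorm_lt (p := p) ((hstep t (by omega)).trans_le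
            (Nat.pow_le_pow_right (by norm_num) h1))
          rw [DFinsupp.add_apply, DFinsupp.neg_apply, neg_add_eq_zero] at h2
          rw [← h2, ih (by omega)]
      simp [hconst m le_rfl]
    rcases le_or_gt (p.1 * (n + p.1) + p.1) e with h2 | h2
    · calc _ ≤ torusScale n p.1 * 2 ^ (n + p.1) := Nat.mul_le_mul_left _
            ((ZMod.natAbs_valMinAbs_le _).trans (Nat.div_le_self _ _))
        _ = 2 ^ (n + (p.1 * (n + p.1) + p.1)) := by
            rw [torusScale, ← pow_add]
            congr 1
            ring
        _ ≤ 2 ^ (n + e) := Nat.pow_le_pow_right (by norm_num) (by omega)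
        _ = 2 ^ n * 2 ^ e := pow_add _ _ _
    · have he : 2 ^ e = torusScale n p.1 * 2 ^ (e - p.1 * (n + p.1)) := by
        rw [torusScale, ← pow_add]
        congr 1
        omega
      have hin : (i : ℤ) < 2 ^ n := by
        exact_mod_cast hi.trans_lt Nat.lt_two_pow_self
      have := natAbs_valMinAbs_le_of_chain (n := n) (j := p.1) (r := e - p.1 * (n + p.1))
        (by omega) (Int.natCast_nonneg i) hin (fun t => (c t).toAdd p) m
        (fun t ht => hc t ht p h1 h2) (fun t ht => by
          have h3 := (le_torusNorm _ p).trans_lt (hstep t ht)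
          rw [he] at h3
          exact lt_of_mul_lt_mul_left h3 (Nat.zero_le _))
      rw [he, mul_left_comm]
      exact Nat.mul_le_mul_left _ this
  rw [torusDist]
  exact_mod_cast key

lemma anDimLE_torusDist (n : ℕ) : ANdimLE (torusDist n) n := by
  refine ⟨2 ^ n * 2, by positivity, 2 ^ n, fun s hs => ?_⟩
  obtain ⟨e, he1, he2⟩ := exists_two_pow_near hs
  refine ⟨fun i => torusColour n e i, exists_mem_torusColour e, fun i x y h => ?_⟩
  have h1 := torusDist_le_of_scaleChain (Nat.lt_succ_iff.mp i.2) he1 h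
  have h2 := mul_le_mul_of_nonneg_left he2 (show (0 : ℝ) ≤ 2 ^ n by positivity)
  linarith

/-- The embedding of a dilated grid in the `j`-th torus. -/
def torusGrid (n j : ℕ) (y : Fin n → ℕ) : TorusSum n :=
  DFinsupp.mk ({j} ×ˢ Finset.univ) fun p => (y p.1.2 : ZMod (2 ^ (n + p.1.1)))

lemma torusGrid_apply_self {n j : ℕ} (y : Fin n → ℕ) (i : Fin n) :
    torusGrid n j y (j, i) = (y i : ZMod (2 ^ (n + j))) := by
  simp [torusGrid, DFinsupp.mk_apply]

lemma torusGrid_apply_of_ne {n j : ℕ} (y : Fin n → ℕ) {p : ℕ × Fin n} (h : p.1 ≠ j) :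
    torusGrid n j y p = 0 := by
  rw [torusGrid, DFinsupp.mk_apply, dif_neg]
  rw [Finset.mem_product, Finset.mem_singleton]
  exact fun hp => h hp.1

lemma torusNorm_torusGrid_le {n j : ℕ} {y z : Fin n → ℕ}
    (h : ∀ i, y i ≤ z i + 1 ∧ z i ≤ y i + 1) :
    torusNorm (-torusGrid n j y + torusGrid n j z) ≤ torusScale n j := by
  refine torusNorm_le_iff.mpr fun p => ?_
  by_cases hp : p.1 = j
  · obtain ⟨j', i⟩ := p
    subst hp
    rw [DFinsupp.add_apply, DFinsupp.neg_apply, torusGrid_apply_self, torusGrid_apply_self]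
    have h1 : -(y i : ZMod (2 ^ (n + j'))) + (z i : ZMod (2 ^ (n + j'))) =
        ((-(y i : ℤ) + (z i : ℤ) : ℤ) : ZMod (2 ^ (n + j'))) := by
      push_cast
      rfl
    rw [h1]
    refine mul_le_of_le_one_right (Nat.zero_le _) ?_
    have := h i
    exact (natAbs_valMinAbs_intCast_le _).trans (by omega)
  · simp [torusGrid_apply_of_ne _ hp]

lemma le_torusNorm_torusGrid {n j : ℕ} {y z : Fin n → ℕ} {i : Fin n} (hy : y i = 1)
    (hz : z i = 2 ^ j + 1) :
    torusScale n j * 2 ^ j ≤ torusNorm (-torusGrid n j y + torusGrid n j z) := by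
  refine le_trans (le_of_eq ?_) (le_torusNorm _ (j, i))
  rw [DFinsupp.add_apply, DFinsupp.neg_apply, torusGrid_apply_self, torusGrid_apply_self, hy, hz]
  have h1 : (-((1 : ℕ) : ZMod (2 ^ (n + j))) + ((2 ^ j + 1 : ℕ) : ZMod (2 ^ (n + j)))) =
      ((2 ^ j : ℕ) : ZMod (2 ^ (n + j))) := by
    push_cast
    ring
  have h2 : 2 ^ j ≤ 2 ^ (n + j) / 2 := by
    rw [Nat.le_div_iff_mul_le two_pos, ← pow_succ]
    exact Nat.pow_le_pow_right (by norm_num) (by have := i.pos; omega)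
  rw [h1, ZMod.valMinAbs_natCast_of_le_half h2, Int.natAbs_natCast]

lemma ScaleChain.refl {X : Type*} {d : X → X → ℝ} {s : ℝ} {U : Set X} {x : X} (hx : x ∈ U) :
    ScaleChain d s U x x :=
  ⟨0, fun _ => x, rfl, rfl, fun _ _ => hx, fun _ h => absurd h (Nat.not_lt_zero _)⟩

lemma ScaleChain.cons {X : Type*} {d : X → X → ℝ} {s : ℝ} {U : Set X} {x y z : X} (hx : x ∈ U)
    (hxy : d x y < s) (h : ScaleChain d s U y z) : ScaleChain d s U x z := by
  obtain ⟨m, c, rfl, rfl, hc, hd⟩ := h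
  refine ⟨m + 1, fun t => Nat.casesOn t x c, rfl, rfl, fun t ht => ?_, fun t ht => ?_⟩
  · cases t with
    | zero => exact hx
    | succ t => exact hc t (by omega)
  · cases t with
    | zero => exact hxy
    | succ t => exact hd t (by omega)

lemma not_anDimLE_torusDist {n m : ℕ} (hmn : m < n) : ¬ ANdimLE (torusDist n) m := by
  rintro ⟨C, -, b, h⟩
  obtain ⟨j, hj⟩ := pow_unbounded_of_one_lt (2 * C + |b|) one_lt_two
  have hpos : (1 : ℝ) ≤ torusScale n j := by exact_mod_cast torusScale_pos n j
  obtain ⟨U, hU, hd⟩ := h (2 * torusScale n j) (by positivity)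
  let φ : (Fin n → ℕ) → Multiplicative (TorusSum n) := fun y =>
    Multiplicative.ofAdd (torusGrid n j y)
  choose k hk using fun y => hU (φ y)
  refine hex n (2 ^ j + 1) (Nat.succ_pos _) (fun y => Fin.castLE hmn (k y))
    (fun y => (∀ i, 0 < y i ∧ y i ≤ 2 ^ j + 1) → ∃ z, z (Fin.castLE hmn (k y)) = 2 ^ j + 1 ∧
      ScaleChain (torusDist n) (2 * torusScale n j) (U (k y)) (φ y) (φ z)) ?_ ?_ ?_
  · exact fun y _ hy _ => ⟨y, hy, ScaleChain.refl (hk y)⟩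
  · intro y z hy _ hyz hcol hP _
    obtain ⟨w, hw, hchain⟩ := hP hy
    have hkk : k y = k z := Fin.castLE_injective _ hcol
    rw [hkk] at hw hchain
    refine ⟨w, hw, ScaleChain.cons (hk z) ?_ hchain⟩
    have h1 : torusDist n (φ z) (φ y) ≤ torusScale n j :=
      Nat.cast_le.mpr (torusNorm_torusGrid_le fun i => (hyz i).symm)
    linarith
  · intro y hy hP hy1
    obtain ⟨z, hz, hchain⟩ := hP hy
    have h1 := hd _ _ _ hchain
    have h2 : (torusScale n j : ℝ) * 2 ^ j ≤ torusDist n (φ y) (φ z) := by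
      have := le_torusNorm_torusGrid hy1 hz
      rw [torusDist]
      exact_mod_cast this
    have h3 := le_abs_self b
    have h4 := abs_nonneg b
    nlinarith

/-- For each `n` there is a countable locally finite group with a proper left invariant
metric whose asymptotic Assouad-Nagata dimension is exactly `n`. -/
theorem exists_locally_finite_group_asdimAN_eq (n : ℕ) :
    ∃ (G : Type) (inst : Group G) (d : G → G → ℝ),
      Countable G ∧ @LocallyFiniteGroup G inst ∧ @IsPLIMetric G inst d ∧
        ANdimLE d n ∧ ∀ m : ℕ, m < n → ¬ ANdimLE d m := by
  exact ⟨Multiplicative (TorusSum n), inferInstance, torusDist n,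
    countable_of_isPLIMetric (isPLIMetric_torusDist n), locallyFiniteGroup_torusSum n,
    isPLIMetric_torusDist n, anDimLE_torusDist n, fun _ hm => not_anDimLE_torusDist hm⟩
end
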